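/- arXiv:0910.4673 — 10 statements merged into one kernel-verified Lean document; each statement's English description precedes it below -/
import Mathlib

section
/- Let n be a positive integer and let P(x) = ∑_{k=0}^{2n} a_k x^k be a real polynomial with all coefficients a_0, a_1, …, a_{2n} strictly positive. If a_{2k+1}^2 / (a_{2k} · a_{2k+2}) < 1 / cos²(π/(n+2)) for all k = 0, 1, …, n−1, then P(x) > 0 for every real x. -/
theorem aux_step (P Q R c u v : ℝ) (hP : 0 < P) (hR : 0 < R) (hu : 0 < u) (hv : 0 < v)
    (h : c ^ 2 * Q ^ 2 < P * R) : 0 < P * (v / u) + R * (u / v) + 2 * c * Q := by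
  have h1 : (P * (v / u)) * (R * (u / v)) = P * R := by field_simp
  have hA : 0 < P * (v / u) := by positivity
  have hB : 0 < R * (u / v) := by positivity
  generalize P * (v / u) = A at *
  generalize R * (u / v) = B at *
  have h2 : (2 * c * Q) ^ 2 < (A + B) ^ 2 := by nlinarith [sq_nonneg (A - B)]
  have := (abs_lt_of_sq_lt_sq' h2 (by positivity)).1
  linarith

theorem positive_poly_even_degree (n : ℕ) (hn : 0 < n) (a : ℕ → ℝ)
    (hpos : ∀ k ≤ 2 * n, 0 < a k)
    (hineq : ∀ k < n,
      (a (2 * k + 1)) ^ 2 / (a (2 * k) * a (2 * k + 2))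
        < 1 / Real.cos (Real.pi / ((n : ℝ) + 2)) ^ 2) :
    ∀ x : ℝ, 0 < ∑ k ∈ Finset.range (2 * n + 1), a k * x ^ k := by
  intro x
  rcases eq_or_ne x 0 with rfl | hx
  · rw [Finset.sum_range_succ']
    simpa using hpos 0 (by omega)
  have hx2 : 0 < x ^ 2 := by positivity
  have hn1 : (1 : ℝ) ≤ n := by exact_mod_cast hn
  have hpi := Real.pi_pos
  set θ := Real.pi / ((n : ℝ) + 2) with hθ
  have hθn : θ * ((n : ℝ) + 2) = Real.pi := by rw [hθ]; field_simp
  have hθ0 : 0 < θ := by positivity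
  have hc : 0 < Real.cos θ := by
    apply Real.cos_pos_of_mem_Ioo
    constructor <;> nlinarith
  have hs : ∀ m : ℕ, m ≤ n → 0 < Real.sin (((m : ℝ) + 1) * θ) := by
    intro m hm
    have hm' : (m : ℝ) ≤ n := by exact_mod_cast hm
    apply Real.sin_pos_of_pos_of_lt_pi
    · positivity
    · nlinarith
  have key : ∀ m : ℕ, m < n → 0 < a (2*m) * x^(2*m) *
      (Real.sin (((m : ℝ) + 2) * θ) / Real.sin (((m : ℝ) + 1) * θ))
      + a (2*m+2) * x^(2*m+2) *
      (Real.sin (((m : ℝ) + 1) * θ) / Real.sin (((m : ℝ) + 2) * θ))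
      + 2 * Real.cos θ * (a (2*m+1) * x^(2*m+1)) := by
    intro m hm
    have p0 := hpos (2*m) (by omega)
    have p2 := hpos (2*m+2) (by omega)
    have e0 : 0 < x^(2*m) := by rw [pow_mul]; positivity
    have e2 : 0 < x^(2*m+2) := by rw [pow_add]; positivity
    have hv := hs (m+1) (by omega)
    have ev : (((m+1 : ℕ) : ℝ) + 1) = (m : ℝ) + 2 := by push_cast; ring
    rw [ev] at hv
    apply aux_step _ _ _ _ _ _ (by positivity) (by positivity) (hs m hm.le) hv
    have h := hineq m hm
    rw [div_lt_div_iff₀ (by positivity) (by positivity)] at h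
    have h3 := mul_lt_mul_of_pos_right h (mul_pos e0 e2)
    have e : (x^(2*m+1))^2 = x^(2*m) * x^(2*m+2) := by ring
    rw [mul_pow, e]
    linarith
  have rec' : ∀ m : ℕ, Real.sin (((m : ℝ) + 3) * θ) =
      2 * Real.cos θ * Real.sin (((m : ℝ) + 2) * θ) - Real.sin (((m : ℝ) + 1) * θ) := by
    intro m
    rw [show ((m : ℝ) + 3) * θ = ((m : ℝ) + 2) * θ + θ by ring,
      show ((m : ℝ) + 1) * θ = ((m : ℝ) + 2) * θ - θ by ring, Real.sin_add, Real.sin_sub]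
    ring
  have step : ∀ m : ℕ, m < n →
      a (2*m) * x^(2*m) * (Real.sin (((m : ℝ) + 2) * θ) / Real.sin (((m : ℝ) + 1) * θ)) ≤
        2 * Real.cos θ * ∑ k ∈ Finset.range (2 * m + 1), a k * x ^ k →
      a (2*m+2) * x^(2*m+2) * (Real.sin (((m : ℝ) + 3) * θ) / Real.sin (((m : ℝ) + 2) * θ)) <
        2 * Real.cos θ * ∑ k ∈ Finset.range (2 * m + 2 + 1), a k * x ^ k := by
    intro m hm ih
    have hv := hs (m+1) (by omega)
    have ev : (((m+1 : ℕ) : ℝ) + 1) = (m : ℝ) + 2 := by push_cast; ring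
    rw [ev] at hv
    rw [Finset.sum_range_succ, Finset.sum_range_succ, rec', sub_div, mul_div_assoc,
      div_self hv.ne']
    have := key m hm
    linarith
  have main : ∀ m : ℕ, m ≤ n →
      a (2*m) * x^(2*m) * (Real.sin (((m : ℝ) + 2) * θ) / Real.sin (((m : ℝ) + 1) * θ)) ≤
        2 * Real.cos θ * ∑ k ∈ Finset.range (2 * m + 1), a k * x ^ k := by
    intro m
    induction m with
    | zero =>
      intro _
      have h0 := hs 0 (by omega)
      simp only [Nat.cast_zero, zero_add, one_mul] at h0
      simp [Real.sin_two_mul]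
      field_simp
      rfl
    | succ m ih =>
      intro hm
      have := (step m (by omega) (ih (by omega))).le
      have e3 : (((m+1 : ℕ) : ℝ) + 2) = (m : ℝ) + 3 := by push_cast; ring
      have e2 : (((m+1 : ℕ) : ℝ) + 1) = (m : ℝ) + 2 := by push_cast; ring
      rw [e3, e2, show 2 * (m + 1) = 2 * m + 2 by ring]
      exact this
  obtain ⟨m, rfl⟩ : ∃ m, n = m + 1 := ⟨n - 1, by omega⟩
  have := step m (by omega) (main m (by omega))
  have e : ((m : ℝ) + 3) * θ = Real.pi := by
    rw [← hθn]; push_cast; ring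
  rw [e, Real.sin_pi, zero_div, mul_zero] at this
  exact pos_of_mul_pos_right this (by positivity)
end

section
/- For every positive integer n there exists a polynomial Q(x) = ∑_{k=0}^{2n} a_k x^k whose coefficients a_0, …, a_{2n} are all strictly positive, such that a_{2k+1}^2 / (a_{2k} · a_{2k+2}) = 1 / cos²(π/(n+2)) for all k = 0, 1, …, n−1, and Q has at least two real zeros counted with multiplicity (in fact −1 is a real zero of Q of multiplicity at least 2). -/
theorem sharp_aux (a s : ℕ → ℝ) (c : ℝ) (hc : c ≠ 0)
    (he : ∀ k, a (2 * k) = s k ^ 2) (ho : ∀ k, a (2 * k + 1) = s k * s (k + 1) / c)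
    (h0 : s 1 = 2 * c * s 0) (hs : ∀ k, s (k + 2) = 2 * c * s (k + 1) - s k) (m : ℕ) :
    Polynomial.eval (-1)
        (∑ k ∈ Finset.range (2 * m + 1), Polynomial.C (a k) * Polynomial.X ^ k)
        = s m * s (m + 1) / (2 * c) ∧
    Polynomial.eval (-1) (Polynomial.derivative
        (∑ k ∈ Finset.range (2 * m + 1), Polynomial.C (a k) * Polynomial.X ^ k))
        = - m * (s m * s (m + 1)) / c := by
  induction m with
  | zero =>
    have := he 0
    simp only [mul_zero] at this
    constructor
    · simp [this, h0]
      field_simp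
    · simp
  | succ m ih =>
    obtain ⟨h1, h2⟩ := ih
    have e1 : (-1 : ℝ) ^ (2 * m) = 1 := by simp
    have he' : a (2 * m + 1 + 1) = s (m + 1) ^ 2 := he (m + 1)
    have hs' : s (m + 1 + 1) = 2 * c * s (m + 1) - s m := hs m
    rw [show 2 * (m + 1) + 1 = 2 * m + 1 + 1 + 1 by ring, Finset.sum_range_succ,
      Finset.sum_range_succ]
    constructor
    · rw [Polynomial.eval_add, Polynomial.eval_add, h1]
      simp only [Polynomial.eval_mul, Polynomial.eval_C, Polynomial.eval_pow, Polynomial.eval_X,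
        pow_succ, e1, he', ho, hs']
      field_simp
      ring
    · rw [Polynomial.derivative_add, Polynomial.derivative_add, Polynomial.eval_add,
        Polynomial.eval_add, h2,
        Polynomial.derivative_C_mul_X_pow, Polynomial.derivative_C_mul_X_pow]
      simp only [Polynomial.eval_mul, Polynomial.eval_C,
        Polynomial.eval_pow, Polynomial.eval_X, Nat.add_sub_cancel,
        pow_succ, e1, he', ho, hs']
      push_cast
      field_simp
      have e3 : (-1 : ℝ) ^ (m * 2) = 1 := by rw [mul_comm]; exact e1
      ring_nf
      rw [e3]
      ring

theorem sharpness_even_degree (n : ℕ) (hn : 0 < n) :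
    ∃ a : ℕ → ℝ,
      (∀ k ≤ 2 * n, 0 < a k) ∧
      (∀ k < n,
        (a (2 * k + 1)) ^ 2 / (a (2 * k) * a (2 * k + 2))
          = 1 / Real.cos (Real.pi / ((n : ℝ) + 2)) ^ 2) ∧
      2 ≤ Polynomial.rootMultiplicity (-1)
        (∑ k ∈ Finset.range (2 * n + 1), Polynomial.C (a k) * Polynomial.X ^ k) := by
  have hn' : (0 : ℝ) < n := by exact_mod_cast hn
  have hpi := Real.pi_pos
  obtain ⟨t, ht⟩ : ∃ t, t = Real.pi / ((n : ℝ) + 2) := ⟨_, rfl⟩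
  have htm : ((n : ℝ) + 2) * t = Real.pi := by rw [ht]; field_simp
  have ht0 : 0 < t := by rw [ht]; positivity
  rw [← ht]
  have hc : 0 < Real.cos t := Real.cos_pos_of_mem_Ioo ⟨by linarith, by nlinarith⟩
  obtain ⟨s, hsd⟩ : ∃ s : ℕ → ℝ, ∀ k, s k = Real.sin (((k : ℝ) + 1) * t) := ⟨_, fun _ => rfl⟩
  obtain ⟨a, ha⟩ : ∃ a : ℕ → ℝ, ∀ k, a k = if k % 2 = 0 then s (k / 2) ^ 2
      else s (k / 2) * s (k / 2 + 1) / Real.cos t := ⟨_, fun _ => rfl⟩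
  have he : ∀ k, a (2 * k) = s k ^ 2 := by intro k; rw [ha]; simp
  have ho : ∀ k, a (2 * k + 1) = s k * s (k + 1) / Real.cos t := by
    intro k
    rw [ha, if_neg (by omega), show (2 * k + 1) / 2 = k by omega]
  have hpos : ∀ k ≤ n, 0 < s k := by
    intro k hk
    have hk' : (k : ℝ) ≤ n := by exact_mod_cast hk
    rw [hsd]
    apply Real.sin_pos_of_pos_of_lt_pi
    · positivity
    · nlinarith
  have h0 : s 1 = 2 * Real.cos t * s 0 := by
    rw [hsd, hsd]
    norm_num
    rw [Real.sin_two_mul]; ring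
  have hs : ∀ k, s (k + 2) = 2 * Real.cos t * s (k + 1) - s k := by
    intro k
    rw [hsd, hsd, hsd]
    push_cast
    rw [show ((k : ℝ) + 2 + 1) * t = ((k : ℝ) + 1 + 1) * t + t by ring,
      show ((k : ℝ) + 1) * t = ((k : ℝ) + 1 + 1) * t - t by ring, Real.sin_add, Real.sin_sub]
    ring
  have hend : s (n + 1) = 0 := by
    rw [hsd]; push_cast
    rw [show ((n : ℝ) + 1 + 1) * t = Real.pi by linarith, Real.sin_pi]
  have hap : ∀ k ≤ 2 * n, 0 < a k := by
    intro k hk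
    rcases Nat.even_or_odd' k with ⟨j, rfl | rfl⟩
    · rw [he]; exact pow_pos (hpos j (by omega)) 2
    · rw [ho]
      exact div_pos (mul_pos (hpos j (by omega)) (hpos (j + 1) (by omega))) hc
  refine ⟨a, hap, ?_, ?_⟩
  · intro k hk
    have e2 : a (2 * k + 2) = s (k + 1) ^ 2 := he (k + 1)
    have p1 := hpos k (by omega)
    have p2 := hpos (k + 1) (by omega)
    rw [he, ho, e2]
    field_simp
  · obtain ⟨h1, h2⟩ := sharp_aux a s (Real.cos t) hc.ne' he ho h0 hs n
    rw [hend] at h1 h2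
    have hne : (∑ k ∈ Finset.range (2 * n + 1), Polynomial.C (a k) * Polynomial.X ^ k) ≠ 0 := by
      intro h
      have h3 := congrArg (fun p => Polynomial.coeff p 0) h
      simp [Polynomial.coeff_X_pow] at h3
      exact (hap 0 (by omega)).ne' h3
    apply (Polynomial.one_lt_rootMultiplicity_iff_isRoot hne).2
    simp only [Polynomial.IsRoot.def]
    exact ⟨by rw [h1]; simp, by rw [h2]; simp⟩
end

section
/- Let n be a positive integer and let P(x) = ∑_{k=0}^{2n+1} a_k x^k be a real polynomial with all coefficients a_0, a_1, …, a_{2n+1} strictly positive. If a_{2k}^2 / (a_{2k−1} · a_{2k+1}) < ((4k² − 1)/(4k²)) · (1 / cos²(π/(n+2))) for all k = 1, 2, …, n, then P has exactly one real zero counted with multiplicity. -/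
theorem aux_quad (θ : ℝ) (y : ℕ → ℝ) (n : ℕ) (hs : ∀ k ≤ n, 0 < Real.sin (((k : ℝ) + 1) * θ)) :
    ∀ m ≤ n, 2 * ∑ k ∈ Finset.range m, y k * y (k + 1) ≤
      2 * Real.cos θ * ∑ k ∈ Finset.range m, y k ^ 2
        + Real.sin ((m : ℝ) * θ) / Real.sin (((m : ℝ) + 1) * θ) * y m ^ 2 := by
  intro m
  induction m with
  | zero => intro _; simp
  | succ m ih =>
    intro hm
    have h := ih (by omega)
    have h1 := hs m (by omega)
    have h2 := hs (m + 1) hm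
    rw [Finset.sum_range_succ, Finset.sum_range_succ]
    push_cast at h2 ⊢
    have hrec : Real.sin ((m : ℝ) * θ) + Real.sin (((m : ℝ) + 1 + 1) * θ)
        = 2 * Real.cos θ * Real.sin (((m : ℝ) + 1) * θ) := by
      have e1 : (m : ℝ) * θ = ((m : ℝ) + 1) * θ - θ := by ring
      have e2 : ((m : ℝ) + 1 + 1) * θ = ((m : ℝ) + 1) * θ + θ := by ring
      rw [e1, e2, Real.sin_sub, Real.sin_add]; ring
    set u := Real.sin ((m : ℝ) * θ)
    set v := Real.sin (((m : ℝ) + 1) * θ)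
    set w := Real.sin (((m : ℝ) + 1 + 1) * θ)
    have hu : u / v = 2 * Real.cos θ - w / v := by
      field_simp; linarith
    rw [hu] at h
    have key : 2 * (y m * y (m + 1)) ≤ w / v * y m ^ 2 + v / w * y (m + 1) ^ 2 := by
      have : w / v * y m ^ 2 + v / w * y (m + 1) ^ 2 - 2 * (y m * y (m + 1))
          = (w * y m - v * y (m + 1)) ^ 2 / (v * w) := by
        field_simp; ring
      have h3 : 0 ≤ (w * y m - v * y (m + 1)) ^ 2 / (v * w) := by positivity
      linarith
    linarith

theorem aux_pairs (a : ℕ → ℝ) (x : ℝ) (n : ℕ) :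
    ∑ k ∈ Finset.range (2 * n + 2), a k * x ^ k
      = ∑ j ∈ Finset.range (n + 1), (a (2 * j) + a (2 * j + 1) * x) * x ^ (2 * j) := by
  induction n with
  | zero => simp [Finset.sum_range_succ]
  | succ n ih =>
    rw [show 2 * (n + 1) + 2 = 2 * n + 2 + 1 + 1 by ring, Finset.sum_range_succ,
      Finset.sum_range_succ, ih, Finset.sum_range_succ _ (n + 1),
      show 2 * (n + 1) = 2 * n + 2 by ring]
    ring

theorem aux_deriv (a : ℕ → ℝ) (x : ℝ) (n : ℕ) :
    ∑ k ∈ Finset.range (2 * n + 2), a k * (k * x ^ (k - 1))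
      = ∑ k ∈ Finset.range (n + 1), (2 * (k : ℝ) + 1) * a (2 * k + 1) * x ^ (2 * k)
        + ∑ k ∈ Finset.range n, (2 * (k : ℝ) + 2) * a (2 * k + 2) * x ^ (2 * k + 1) := by
  induction n with
  | zero => simp [Finset.sum_range_succ]
  | succ n ih =>
    rw [show 2 * (n + 1) + 2 = 2 * n + 2 + 1 + 1 by ring, Finset.sum_range_succ,
      Finset.sum_range_succ, ih, Finset.sum_range_succ _ (n + 1),
      Finset.sum_range_succ (fun k : ℕ => (2 * (k : ℝ) + 2) * a (2 * k + 2) * x ^ (2 * k + 1)) n,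
      show 2 * (n + 1) = 2 * n + 2 by ring, show 2 * n + 2 - 1 = 2 * n + 1 by omega,
      show 2 * n + 2 + 1 - 1 = 2 * n + 2 by omega]
    push_cast
    ring

theorem odd_degree_one_real_zero (n : ℕ) (hn : 0 < n) (a : ℕ → ℝ)
    (hpos : ∀ k ≤ 2 * n + 1, 0 < a k)
    (hineq : ∀ k, 1 ≤ k → k ≤ n →
      (a (2 * k)) ^ 2 / (a (2 * k - 1) * a (2 * k + 1))
        < ((4 * (k : ℝ) ^ 2 - 1) / (4 * (k : ℝ) ^ 2))
            * (1 / Real.cos (Real.pi / ((n : ℝ) + 2)) ^ 2)) :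
    (∑ k ∈ Finset.range (2 * n + 2),
      Polynomial.C (a k) * Polynomial.X ^ k : Polynomial ℝ).roots.card = 1 := by
  set θ := Real.pi / ((n : ℝ) + 2) with hθ
  have hn1 : (1 : ℝ) ≤ n := by exact_mod_cast hn
  have hθ0 : 0 < θ := by positivity
  have hθm : ((n : ℝ) + 2) * θ = Real.pi := by rw [hθ]; field_simp
  have hs : ∀ k ≤ n, 0 < Real.sin (((k : ℝ) + 1) * θ) := by
    intro k hk
    have hk' : (k : ℝ) ≤ n := by exact_mod_cast hk
    apply Real.sin_pos_of_pos_of_lt_pi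
    · positivity
    · nlinarith
  have hc : 0 < Real.cos θ := by
    apply Real.cos_pos_of_mem_Ioo
    constructor <;> nlinarith [Real.pi_pos]
  have hquad : ∀ y : ℕ → ℝ, ∑ k ∈ Finset.range n, y k * y (k + 1) ≤
      Real.cos θ * ∑ k ∈ Finset.range (n + 1), y k ^ 2 := by
    intro y
    have h := aux_quad θ y n hs n le_rfl
    have e : Real.sin ((n : ℝ) * θ) = 2 * Real.cos θ * Real.sin (((n : ℝ) + 1) * θ) := by
      have e1 : (n : ℝ) * θ = Real.pi - 2 * θ := by linarith
      have e2 : ((n : ℝ) + 1) * θ = Real.pi - θ := by linarith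
      rw [e1, e2, Real.sin_pi_sub, Real.sin_pi_sub, Real.sin_two_mul]; ring
    rw [e, mul_div_assoc, div_self (hs n le_rfl).ne'] at h
    rw [Finset.sum_range_succ]
    linarith
  set p := (∑ k ∈ Finset.range (2 * n + 2),
      Polynomial.C (a k) * Polynomial.X ^ k : Polynomial ℝ) with hp
  have heval : ∀ x, p.eval x = ∑ k ∈ Finset.range (2 * n + 2), a k * x ^ k := by
    intro x; simp [hp, Polynomial.eval_finsetSum]
  have hderiv : ∀ x, 0 < p.derivative.eval x := by
    intro x
    have e : p.derivative.eval x = ∑ k ∈ Finset.range (2 * n + 2), a k * (k * x ^ (k - 1)) := by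
      simp [hp, Polynomial.eval_finsetSum, Polynomial.derivative_X_pow]
    rw [e, aux_deriv]
    rcases eq_or_ne x 0 with rfl | hx
    · rw [Finset.sum_range_succ']
      simp
      exact hpos 1 (by omega)
    have hx' : 0 < |x| := abs_pos.mpr hx
    set d : ℕ → ℝ := fun k => (2 * (k : ℝ) + 1) * a (2 * k + 1) with hd
    have hd0 : ∀ k ≤ n, 0 < d k := fun k hk =>
      mul_pos (by positivity) (hpos _ (by omega))
    have h := hquad (fun k => Real.sqrt (d k) * |x| ^ k)
    have hsum : ∑ k ∈ Finset.range (n + 1), (Real.sqrt (d k) * |x| ^ k) ^ 2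
        = ∑ k ∈ Finset.range (n + 1), (2 * (k : ℝ) + 1) * a (2 * k + 1) * x ^ (2 * k) := by
      apply Finset.sum_congr rfl
      intro k hk
      rw [Finset.mem_range] at hk
      rw [mul_pow, Real.sq_sqrt (hd0 k (by omega)).le, ← pow_mul, mul_comm k 2, pow_mul, sq_abs,
        ← pow_mul]
    simp only [hsum] at h
    have hlt : Real.cos θ * ∑ k ∈ Finset.range n, -((2 * (k : ℝ) + 2) * a (2 * k + 2) * x ^ (2 * k + 1))
        < ∑ k ∈ Finset.range n, Real.sqrt (d k) * |x| ^ k * (Real.sqrt (d (k + 1)) * |x| ^ (k + 1)) := by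
      rw [Finset.mul_sum]
      apply Finset.sum_lt_sum_of_nonempty ⟨0, by simpa using hn⟩
      intro k hk
      rw [Finset.mem_range] at hk
      have h0 := hineq (k + 1) (by omega) (by omega)
      rw [show 2 * (k + 1) - 1 = 2 * k + 1 by omega, show 2 * (k + 1) + 1 = 2 * k + 3 by ring,
        show 2 * (k + 1) = 2 * k + 2 by ring] at h0
      have p1 := hpos (2 * k + 1) (by omega)
      have p2 := hpos (2 * k + 2) (by omega)
      have p3 := hpos (2 * k + 3) (by omega)
      push_cast at h0
      have h1 : (Real.cos θ * ((2 * (k : ℝ) + 2) * a (2 * k + 2))) ^ 2 < d k * d (k + 1) := by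
        rw [div_lt_iff₀ (by positivity)] at h0
        have hmul := mul_lt_mul_of_pos_left h0
          (show 0 < Real.cos θ ^ 2 * (2 * (k : ℝ) + 2) ^ 2 by positivity)
        have e3 : Real.cos θ ^ 2 * (2 * (k : ℝ) + 2) ^ 2 *
            ((4 * ((k : ℝ) + 1) ^ 2 - 1) / (4 * ((k : ℝ) + 1) ^ 2) * (1 / Real.cos θ ^ 2) *
              (a (2 * k + 1) * a (2 * k + 3))) = d k * d (k + 1) := by
          simp only [hd, show 2 * (k + 1) + 1 = 2 * k + 3 by ring]
          push_cast
          field_simp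
          ring
        rw [e3] at hmul
        calc _ = _ := by ring
          _ < _ := hmul
      have h2 : Real.cos θ * ((2 * (k : ℝ) + 2) * a (2 * k + 2))
          < Real.sqrt (d k) * Real.sqrt (d (k + 1)) := by
        rw [← Real.sqrt_mul (hd0 k (by omega)).le]
        exact Real.lt_sqrt_of_sq_lt h1
      have h3 : -(x ^ (2 * k + 1)) ≤ |x| ^ (2 * k + 1) := by
        rw [← abs_pow]; exact neg_le_abs _
      calc Real.cos θ * -((2 * (k : ℝ) + 2) * a (2 * k + 2) * x ^ (2 * k + 1))
          = Real.cos θ * ((2 * (k : ℝ) + 2) * a (2 * k + 2)) * -(x ^ (2 * k + 1)) := by ring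
        _ ≤ Real.cos θ * ((2 * (k : ℝ) + 2) * a (2 * k + 2)) * |x| ^ (2 * k + 1) :=
            mul_le_mul_of_nonneg_left h3 (by positivity)
        _ < Real.sqrt (d k) * Real.sqrt (d (k + 1)) * |x| ^ (2 * k + 1) :=
            mul_lt_mul_of_pos_right h2 (by positivity)
        _ = _ := by ring
    have h4 := lt_of_mul_lt_mul_left (lt_of_lt_of_le hlt h) hc.le
    rw [Finset.sum_neg_distrib] at h4
    linarith
  have hp0 : p ≠ 0 := by
    intro h0
    have := hderiv 0
    simp [h0] at this
  have hle : p.roots.card ≤ 1 := by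
    have h := Polynomial.card_roots_le_derivative p
    have hz : p.derivative.roots = 0 := by
      apply Multiset.eq_zero_of_forall_notMem
      intro x hx
      exact (hderiv x).ne' (Polynomial.isRoot_of_mem_roots hx)
    simpa [hz] using h
  have hex : ∃ x, p.eval x = 0 := by
    set t : ℝ := 1 + ∑ j ∈ Finset.range (n + 1), a (2 * j) / a (2 * j + 1) with ht
    have hterm : ∀ j ∈ Finset.range (n + 1), 0 < a (2 * j) / a (2 * j + 1) := by
      intro j hj
      rw [Finset.mem_range] at hj
      exact div_pos (hpos _ (by omega)) (hpos _ (by omega))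
    have ht0 : 0 < t := by
      have := Finset.sum_nonneg (fun j hj => (hterm j hj).le)
      linarith
    have hneg : p.eval (-t) < 0 := by
      rw [heval, aux_pairs]
      apply Finset.sum_neg
      · intro j hj
        have h1 := Finset.single_le_sum (fun j hj => (hterm j hj).le) hj
        have h2 : a (2 * j) / a (2 * j + 1) < t := by linarith
        rw [Finset.mem_range] at hj
        rw [div_lt_iff₀ (hpos _ (by omega))] at h2
        apply mul_neg_of_neg_of_pos
        · linarith
        · rw [pow_mul, neg_sq]; positivity
      · exact ⟨0, by simp⟩
    have hpos0 : 0 < p.eval 0 := by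
      rw [heval, Finset.sum_range_succ']
      simpa using hpos 0 (by omega)
    have := intermediate_value_Icc (show -t ≤ 0 by linarith)
      (p.continuous.continuousOn (s := Set.Icc (-t) 0))
    obtain ⟨x, -, hx⟩ := this ⟨hneg.le, hpos0.le⟩
    exact ⟨x, hx⟩
  obtain ⟨x, hx⟩ := hex
  have hge : 0 < p.roots.card := 
    Multiset.card_pos_iff_exists_mem.mpr ⟨x, (Polynomial.mem_roots hp0).mpr hx⟩
  omega
end

section
/- For every positive integer n there exists a polynomial Q(x) = ∑_{k=0}^{2n+1} a_k x^k whose coefficients a_0, …, a_{2n+1} are all strictly positive, such that a_{2k}^2 / (a_{2k−1} · a_{2k+1}) = ((4k² − 1)/(4k²)) · (1 / cos²(π/(n+2))) for all k = 1, 2, …, n, and Q has at least three real zeros counted with multiplicity (in fact −1 is a real zero of Q of multiplicity at least 3). -/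
lemma aux_tel (s w : ℕ → ℝ) (c : ℝ) (h0 : s 0 = 0)
    (hs : ∀ j, s (j + 2) + s j = 2 * c * s (j + 1)) (m : ℕ) :
    ∑ j ∈ Finset.range (m + 1), 2 * c * (s (j + 1) ^ 2 * w j)
      = ∑ j ∈ Finset.range m, s (j + 1) * s (j + 2) * (w j + w (j + 1))
        + s (m + 1) * s (m + 2) * w m := by
  induction m with
  | zero =>
    have := hs 0
    simp only [zero_add, h0, add_zero] at this ⊢
    simp [this]; ring
  | succ m ih =>
    rw [Finset.sum_range_succ, ih, Finset.sum_range_succ]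
    linear_combination (-s (m + 2) * w (m + 1)) * hs (m + 1)

lemma aux_split {M : Type*} [AddCommMonoid M] (f : ℕ → M) (n : ℕ) :
    ∑ k ∈ Finset.range (2 * n + 2), f k = f 0 + ∑ j ∈ Finset.range (n + 1), f (2 * j + 1)
      + ∑ j ∈ Finset.range n, f (2 * j + 2) := by
  induction n with
  | zero => simp [Finset.sum_range_succ]
  | succ n ih =>
    rw [show 2 * (n + 1) + 2 = (2 * n + 2) + 1 + 1 by ring, Finset.sum_range_succ,
      Finset.sum_range_succ, ih, Finset.sum_range_succ _ (n + 1), Finset.sum_range_succ _ n,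
      Finset.sum_range_succ _ n, show 2 * (n + 1) + 1 = 2 * n + 2 + 1 by ring]
    abel

theorem sharpness_odd_degree (n : ℕ) (hn : 0 < n) :
    ∃ a : ℕ → ℝ,
      (∀ k ≤ 2 * n + 1, 0 < a k) ∧
      (∀ k, 1 ≤ k → k ≤ n →
        (a (2 * k)) ^ 2 / (a (2 * k - 1) * a (2 * k + 1))
          = ((4 * (k : ℝ) ^ 2 - 1) / (4 * (k : ℝ) ^ 2))
              * (1 / Real.cos (Real.pi / ((n : ℝ) + 2)) ^ 2)) ∧
      3 ≤ Polynomial.rootMultiplicity (-1)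
        (∑ k ∈ Finset.range (2 * n + 2), Polynomial.C (a k) * Polynomial.X ^ k) := by
  have hn1 : (1 : ℝ) ≤ n := by exact_mod_cast hn
  have hpi := Real.pi_pos
  set t : ℝ := Real.pi / ((n : ℝ) + 2) with ht
  have htn : ((n : ℝ) + 2) * t = Real.pi := by rw [ht]; field_simp
  have htpos : 0 < t := by positivity
  set c := Real.cos t with hc
  have hcpos : 0 < c := Real.cos_pos_of_mem_Ioo ⟨by linarith, by nlinarith⟩
  obtain ⟨s, hsdef⟩ : ∃ s : ℕ → ℝ, ∀ j, s j = Real.sin (j * t) := ⟨_, fun _ => rfl⟩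
  have h0 : s 0 = 0 := by simp [hsdef]
  have hend : s (n + 2) = 0 := by
    rw [hsdef]; push_cast; rw [htn]; simp
  have hrec : ∀ j, s (j + 2) + s j = 2 * c * s (j + 1) := by
    intro j
    simp only [hsdef]
    have e1 : ((j + 2 : ℕ) : ℝ) * t = ((j + 1 : ℕ) : ℝ) * t + t := by push_cast; ring
    have e2 : (j : ℝ) * t = ((j + 1 : ℕ) : ℝ) * t - t := by push_cast; ring
    rw [e1, e2, Real.sin_add, Real.sin_sub]; ring
  have hspos : ∀ j, j < n + 1 → 0 < s (j + 1) := by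
    intro j hj
    rw [hsdef]
    have : ((j + 1 : ℕ) : ℝ) ≤ n + 1 := by exact_mod_cast hj
    apply Real.sin_pos_of_pos_of_lt_pi
    · positivity
    · nlinarith
  have key : ∀ w : ℕ → ℝ, ∑ j ∈ Finset.range (n + 1), (s (j + 1) ^ 2 * w j)
      = ∑ j ∈ Finset.range n, s (j + 1) * s (j + 2) * (w j + w (j + 1)) / (2 * c) := by
    intro w
    have h := aux_tel s w c h0 hrec n
    rw [hend, ← Finset.mul_sum] at h
    rw [← Finset.sum_div, eq_div_iff (by positivity)]
    linarith
  clear_value c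
  obtain ⟨a, ha0, hao, hae⟩ : ∃ a : ℕ → ℝ,
      a 0 = ∑ j ∈ Finset.range (n + 1), s (j + 1) ^ 2 / (2 * j + 1)
        - ∑ j ∈ Finset.range n, s (j + 1) * s (j + 2) / ((2 * j + 2) * c) ∧
      (∀ j : ℕ, a (2 * j + 1) = s (j + 1) ^ 2 / (2 * j + 1)) ∧
      (∀ j : ℕ, a (2 * j + 2) = s (j + 1) * s (j + 2) / ((2 * j + 2) * c)) := by
    refine ⟨fun k => if k = 0 then ∑ j ∈ Finset.range (n + 1), s (j + 1) ^ 2 / (2 * j + 1)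
        - ∑ j ∈ Finset.range n, s (j + 1) * s (j + 2) / ((2 * j + 2) * c)
      else if k % 2 = 0 then s (k / 2) * s (k / 2 + 1) / (k * c) else s (k / 2 + 1) ^ 2 / k,
      by simp, ?_, ?_⟩
    · intro j
      have e1 : (2 * j + 1) % 2 = 1 := by omega
      have e2 : (2 * j + 1) / 2 = j := by omega
      simp [e1, e2]
    · intro j
      have e1 : (2 * j + 2) % 2 = 0 := by omega
      have e2 : (2 * j + 2) / 2 = j + 1 := by omega
      simp [e2]
  have ha0pos : 0 < a 0 := by
    have h := key (fun j => 1 / (2 * (j : ℝ) + 1))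
    simp only [mul_one_div] at h
    rw [ha0, h, ← Finset.sum_sub_distrib]
    apply Finset.sum_pos
    · intro j hj
      have hj := Finset.mem_range.1 hj
      have p1 := hspos j (by omega)
      have p2 := hspos (j + 1) (by omega)
      have : s (j + 1) * s (j + 2) * (1 / (2 * (j : ℝ) + 1) + 1 / (2 * ((j + 1 : ℕ) : ℝ) + 1)) / (2 * c)
          - s (j + 1) * s (j + 2) / ((2 * j + 2) * c)
          = s (j + 1) * s (j + 1 + 1) / (c * ((2 * j + 1) * (2 * j + 2) * (2 * j + 3))) := by
        push_cast
        have : (2 * ((j : ℝ) + 1) + 1) = 2 * j + 3 := by ring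
        rw [this]
        field_simp
        ring
      rw [this]
      positivity
    · exact ⟨0, Finset.mem_range.2 hn⟩
  refine ⟨a, ?_, ?_, ?_⟩
  · intro k hk
    rcases Nat.even_or_odd' k with ⟨j, rfl | rfl⟩
    · rcases j with _ | j
      · simpa using ha0pos
      · have p1 := hspos j (by omega)
        have p2 := hspos (j + 1) (by omega)
        rw [show 2 * (j + 1) = 2 * j + 2 by ring, hae, show j + 2 = j + 1 + 1 by ring]
        positivity
    · have p1 := hspos j (by omega)
      rw [hao]; positivity
  · intro k hk1 hk2
    obtain ⟨j, rfl⟩ : ∃ j, k = j + 1 := ⟨k - 1, by omega⟩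
    have p1 := hspos j (by omega)
    have p2 : 0 < s (j + 2) := hspos (j + 1) (by omega)
    have e1 : 2 * (j + 1) - 1 = 2 * j + 1 := by omega
    rw [e1, hao, hao, show 2 * (j + 1) = 2 * j + 2 by ring, hae, show j + 1 + 1 = j + 2 by ring]
    push_cast
    have : (2 * ((j : ℝ) + 1) + 1) = 2 * j + 3 := by ring
    rw [this]
    field_simp
    ring
  · set P := ∑ k ∈ Finset.range (2 * n + 2), Polynomial.C (a k) * Polynomial.X ^ k with hP
    have hPne : P ≠ 0 := by
      intro h
      have h1 : P.coeff 0 = a 0 := by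
        rw [hP, Polynomial.finsetSum_coeff]
        simp [Polynomial.coeff_C_mul, Polynomial.coeff_X_pow]
      rw [h] at h1
      simp at h1
      linarith
    have hlt : 2 < P.rootMultiplicity (-1) := by
      rw [Polynomial.lt_rootMultiplicity_iff_isRoot_iterate_derivative hPne]
      intro m hm
      rw [Polynomial.IsRoot.def]
      have ho : ∀ j : ℕ, (-1 : ℝ) ^ (2 * j + 1) = -1 := fun j => by simp [pow_succ, pow_mul]
      have he : ∀ j : ℕ, (-1 : ℝ) ^ (2 * j) = 1 := fun j => by simp [pow_mul]
      have he2 : ∀ j : ℕ, (-1 : ℝ) ^ (2 * j + 2) = 1 := fun j => by simp [pow_add, pow_mul]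
      interval_cases m
      · simp only [Function.iterate_zero, id, hP, Polynomial.eval_finsetSum, Polynomial.eval_mul,
          Polynomial.eval_C, Polynomial.eval_pow, Polynomial.eval_X]
        rw [aux_split]
        simp only [hao, hae, ho, he2, ha0, mul_neg, mul_one, Finset.sum_neg_distrib, pow_zero]
        ring
      · have h := key (fun j => 1)
        have hd : P.derivative.eval (-1) =
            ∑ k ∈ Finset.range (2 * n + 2), a k * (k * (-1) ^ (k - 1)) := by
          simp [hP, Polynomial.derivative_X_pow, Polynomial.eval_finsetSum]
        simp only [Function.iterate_one]
        rw [hd, aux_split]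
        have t1 : ∀ j : ℕ, a (2 * j + 1) * (((2 * j + 1 : ℕ) : ℝ) * (-1) ^ (2 * j + 1 - 1))
            = s (j + 1) ^ 2 * 1 := by
          intro j
          rw [hao, Nat.add_sub_cancel, he]; push_cast; field_simp
        have t2 : ∀ j : ℕ, a (2 * j + 2) * (((2 * j + 2 : ℕ) : ℝ) * (-1) ^ (2 * j + 2 - 1))
            = - (s (j + 1) * s (j + 2) * (1 + 1) / (2 * c)) := by
          intro j
          rw [hae, show 2 * j + 2 - 1 = 2 * j + 1 by omega, ho]; push_cast; field_simp; ring
        simp only [t1, t2, h, Finset.sum_neg_distrib]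
        simp
      · have h := key (fun j => 2 * (j : ℝ))
        have hd : P.derivative.derivative.eval (-1) =
            ∑ k ∈ Finset.range (2 * n + 2), a k * (k * (((k - 1 : ℕ) : ℝ) * (-1) ^ (k - 1 - 1))) := by
          simp [hP, Polynomial.derivative_X_pow, Polynomial.eval_finsetSum]
        simp only [Function.iterate_succ, Function.iterate_zero, Function.comp, id]
        rw [hd, aux_split]
        have t1 : ∀ j : ℕ, a (2 * j + 1) * (((2 * j + 1 : ℕ) : ℝ) *
            (((2 * j + 1 - 1 : ℕ) : ℝ) * (-1) ^ (2 * j + 1 - 1 - 1)))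
            = - (s (j + 1) ^ 2 * (2 * (j : ℝ))) := by
          intro j
          rcases j with _ | j
          · simp
          · rw [hao, Nat.add_sub_cancel, show 2 * (j + 1) - 1 = 2 * j + 1 by omega, ho]
            push_cast; field_simp
        have t2 : ∀ j : ℕ, a (2 * j + 2) * (((2 * j + 2 : ℕ) : ℝ) *
            (((2 * j + 2 - 1 : ℕ) : ℝ) * (-1) ^ (2 * j + 2 - 1 - 1)))
            = s (j + 1) * s (j + 2) * (2 * (j : ℝ) + 2 * ((j + 1 : ℕ) : ℝ)) / (2 * c) := by
          intro j
          rw [hae, show 2 * j + 2 - 1 = 2 * j + 1 by omega, Nat.add_sub_cancel, he]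
          push_cast; field_simp; ring
        simp only [t1, t2, Finset.sum_neg_distrib]
        rw [h]
        simp
    exact hlt
end

section
/- Let n be a positive integer and let a_0, a_1, …, a_{2n} be strictly positive real numbers satisfying a_{2k+1}^2 / (a_{2k} · a_{2k+2}) < 1 / cos²(π/(n+2)) for all k = 0, 1, …, n−1. Then the (n+1)×(n+1) real symmetric tridiagonal matrix M with diagonal entries M_{kk} = a_{2k} for k = 0, …, n and off-diagonal entries M_{k,k+1} = M_{k+1,k} = a_{2k+1}/2 for k = 0, …, n−1 is positive definite. -/
/-- The symmetric tridiagonal matrix associated to the quadratic form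
`Q_P(x_0, …, x_n) = ∑ a_{2k} x_k² + ∑ a_{2k+1} x_k x_{k+1}`. -/
noncomputable def tridiagOfCoeffs (n : ℕ) (a : ℕ → ℝ) : Matrix (Fin (n + 1)) (Fin (n + 1)) ℝ :=
  Matrix.of fun i j =>
    if (i : ℕ) = (j : ℕ) then a (2 * (i : ℕ))
    else if (i : ℕ) + 1 = (j : ℕ) then a (2 * (i : ℕ) + 1) / 2
    else if (j : ℕ) + 1 = (i : ℕ) then a (2 * (j : ℕ) + 1) / 2
    else 0

noncomputable def tdEntry (a : ℕ → ℝ) (i j : ℕ) : ℝ :=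
    if i = j then a (2 * i)
    else if i + 1 = j then a (2 * i + 1) / 2
    else if j + 1 = i then a (2 * j + 1) / 2
    else 0

noncomputable def tdForm (a y : ℕ → ℝ) : ℕ → ℝ
  | 0 => a 0 * y 0 ^ 2
  | (k + 1) => tdForm a y k + a (2 * k + 1) * y k * y (k + 1) + a (2 * k + 2) * y (k + 1) ^ 2

lemma td_sum (a y : ℕ → ℝ) (N : ℕ) :
    ∑ i ∈ Finset.range (N + 1), ∑ j ∈ Finset.range (N + 1), y i * (tdEntry a i j * y j)
      = tdForm a y N := by
  induction N with
  | zero => simp [tdEntry, tdForm]; ring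
  | succ N ih =>
    rw [Finset.sum_range_succ]
    simp_rw [Finset.sum_range_succ _ (N + 1)]
    rw [Finset.sum_add_distrib, ih]
    rw [Finset.sum_range_succ (fun x => y x * (tdEntry a x (N + 1) * y (N + 1))),
      Finset.sum_range_succ (fun x => y (N + 1) * (tdEntry a (N + 1) x * y x))]
    have h1 : ∑ x ∈ Finset.range N, y x * (tdEntry a x (N + 1) * y (N + 1)) = 0 := by
      apply Finset.sum_eq_zero
      intro x hx
      have := Finset.mem_range.1 hx
      have : tdEntry a x (N + 1) = 0 := by
        unfold tdEntry
        rw [if_neg (by omega), if_neg (by omega), if_neg (by omega)]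
      simp [this]
    have h2 : ∑ x ∈ Finset.range N, y (N + 1) * (tdEntry a (N + 1) x * y x) = 0 := by
      apply Finset.sum_eq_zero
      intro x hx
      have := Finset.mem_range.1 hx
      have : tdEntry a (N + 1) x = 0 := by
        unfold tdEntry
        rw [if_neg (by omega), if_neg (by omega), if_neg (by omega)]
      simp [this]
    rw [h1, h2]
    have e1 : tdEntry a N (N + 1) = a (2 * N + 1) / 2 := by simp [tdEntry]
    have e2 : tdEntry a (N + 1) N = a (2 * N + 1) / 2 := by
      unfold tdEntry
      rw [if_neg (by omega), if_neg (by omega), if_pos rfl]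
    have e3 : tdEntry a (N + 1) (N + 1) = a (2 * N + 2) := by simp [tdEntry, mul_add]
    rw [e1, e2, e3, tdForm]
    ring

lemma td_step (r A b B c x y : ℝ) (hr : 0 < r) (hA : 0 < A) (hB : 0 < B) (hc : 0 < c)
    (h : b ^ 2 / (A * B) < 1 / c ^ 2) :
    0 ≤ r * A * x ^ 2 + b * x * y + B / (4 * c ^ 2 * r) * y ^ 2 ∧
    (r * A * x ^ 2 + b * x * y + B / (4 * c ^ 2 * r) * y ^ 2 ≤ 0 → x = 0 ∧ y = 0) := by
  rw [div_lt_div_iff₀ (by positivity) (by positivity)] at h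
  set E := r * A * x ^ 2 + b * x * y + B / (4 * c ^ 2 * r) * y ^ 2 with hE
  have key : 4 * c ^ 2 * r * A * E =
      c ^ 2 * (2 * r * A * x + b * y) ^ 2 + (1 * (A * B) - b ^ 2 * c ^ 2) * y ^ 2 := by
    rw [hE]; field_simp; ring
  have hp : 0 < 4 * c ^ 2 * r * A := by positivity
  have hd : 0 < 1 * (A * B) - b ^ 2 * c ^ 2 := by linarith
  have n1 : 0 ≤ c ^ 2 * (2 * r * A * x + b * y) ^ 2 := by positivity
  have n2 : 0 ≤ (1 * (A * B) - b ^ 2 * c ^ 2) * y ^ 2 := by positivity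
  refine ⟨?_, fun hle => ?_⟩
  · exact nonneg_of_mul_nonneg_right (by rw [key]; positivity) hp
  · have h0 : 4 * c ^ 2 * r * A * E ≤ 0 := mul_nonpos_of_nonneg_of_nonpos hp.le hle
    have z2 : (1 * (A * B) - b ^ 2 * c ^ 2) * y ^ 2 = 0 := by linarith
    have z1 : c ^ 2 * (2 * r * A * x + b * y) ^ 2 = 0 := by linarith
    have hy : y = 0 := by
      rcases mul_eq_zero.1 z2 with h | h
      · exact absurd h hd.ne'
      · exact pow_eq_zero_iff (two_ne_zero) |>.1 h
    subst hy
    have := hc.ne'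
    have := hr.ne'
    have := hA.ne'
    simp_all

lemma td_main (n : ℕ) (hn : 0 < n) (a y : ℕ → ℝ)
    (hpos : ∀ k ≤ 2 * n, 0 < a k)
    (hineq : ∀ k < n,
      (a (2 * k + 1)) ^ 2 / (a (2 * k) * a (2 * k + 2))
        < 1 / Real.cos (Real.pi / ((n : ℝ) + 2)) ^ 2) :
    0 ≤ tdForm a y n ∧ (tdForm a y n ≤ 0 → ∀ k ≤ n, y k = 0) := by
  set θ := Real.pi / ((n : ℝ) + 2) with hθ
  have hn1 : (1 : ℝ) ≤ n := by exact_mod_cast hn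
  have hπ := Real.pi_pos
  have hθ0 : 0 < θ := by positivity
  have hθn : ((n : ℝ) + 2) * θ = Real.pi := by rw [hθ]; field_simp
  have hc : 0 < Real.cos θ := by
    apply Real.cos_pos_of_mem_Ioo
    constructor <;> nlinarith
  have hs : ∀ k : ℕ, k ≤ n → 0 < Real.sin (((k : ℝ) + 1) * θ) := by
    intro k hk
    have : (k : ℝ) ≤ n := by exact_mod_cast hk
    apply Real.sin_pos_of_pos_of_lt_pi
    · positivity
    · nlinarith
  have hrec : ∀ k : ℕ, Real.sin (((k : ℝ) + 3) * θ) + Real.sin (((k : ℝ) + 1) * θ)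
      = 2 * Real.cos θ * Real.sin (((k : ℝ) + 2) * θ) := by
    intro k
    rw [show ((k : ℝ) + 3) * θ = ((k : ℝ) + 2) * θ + θ by ring,
      show ((k : ℝ) + 1) * θ = ((k : ℝ) + 2) * θ - θ by ring, Real.sin_add, Real.sin_sub]
    ring
  have claim : ∀ N ≤ n,
      (Real.sin (((N : ℝ) + 2) * θ) / (2 * Real.cos θ * Real.sin (((N : ℝ) + 1) * θ)))
        * a (2 * N) * y N ^ 2 ≤ tdForm a y N ∧
      (tdForm a y N ≤ (Real.sin (((N : ℝ) + 2) * θ) /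
        (2 * Real.cos θ * Real.sin (((N : ℝ) + 1) * θ))) * a (2 * N) * y N ^ 2 →
        (∀ k < N, y k = 0) ∧ (N ≠ 0 → y N = 0)) := by
    intro N
    induction N with
    | zero =>
      intro _
      have h1 := hs 0 (by omega)
      have : Real.sin (((0 : ℕ) + 2 : ℝ) * θ) /
          (2 * Real.cos θ * Real.sin (((0 : ℕ) + 1 : ℝ) * θ)) = 1 := by
        rw [div_eq_one_iff_eq (by positivity)]
        simp [Real.sin_two_mul]; ring
      rw [this]
      simp [tdForm]
    | succ N ih =>
      intro hN
      obtain ⟨i1, i2⟩ := ih (by omega)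
      have s1 := hs N (by omega)
      have s2 := hs (N + 1) hN
      have hr := hrec N
      push_cast at s2 ⊢
      rw [show (N : ℝ) + 1 + 1 = N + 2 by ring] at s2 ⊢
      rw [show (N : ℝ) + 1 + 2 = N + 3 by ring]
      set S1 := Real.sin (((N : ℝ) + 1) * θ)
      set S2 := Real.sin (((N : ℝ) + 2) * θ)
      set S3 := Real.sin (((N : ℝ) + 3) * θ)
      set c := Real.cos θ
      obtain ⟨t1, t2⟩ := td_step (S2 / (2 * c * S1)) (a (2 * N)) (a (2 * N + 1))
        (a (2 * N + 2)) c (y N) (y (N + 1)) (by positivity) (hpos _ (by omega))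
        (hpos _ (by omega)) hc (hineq N (by omega))
      have e : a (2 * N + 2) / (4 * c ^ 2 * (S2 / (2 * c * S1)))
          = a (2 * N + 2) - S3 / (2 * c * S2) * a (2 * N + 2) := by
        rw [show S3 = 2 * c * S2 - S1 by linarith]
        field_simp
        ring
      rw [e] at t1 t2
      rw [show 2 * (N + 1) = 2 * N + 2 by ring, tdForm]
      refine ⟨by linarith, fun hle => ?_⟩
      obtain ⟨z1, z2⟩ := t2 (by linarith)
      obtain ⟨z3, -⟩ := i2 (by linarith)
      refine ⟨fun k hk => ?_, fun _ => z2⟩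
      rcases Nat.lt_succ_iff_lt_or_eq.1 hk with h | h
      · exact z3 k h
      · rw [h]; exact z1
  obtain ⟨c1, c2⟩ := claim n le_rfl
  rw [hθn, Real.sin_pi] at c1 c2
  simp only [zero_div, zero_mul] at c1 c2
  refine ⟨c1, fun h k hk => ?_⟩
  obtain ⟨d1, d2⟩ := c2 h
  rcases hk.lt_or_eq with h | h
  · exact d1 k h
  · rw [h]; exact d2 hn.ne'

theorem tridiag_posDef (n : ℕ) (hn : 0 < n) (a : ℕ → ℝ)
    (hpos : ∀ k ≤ 2 * n, 0 < a k)
    (hineq : ∀ k < n,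
      (a (2 * k + 1)) ^ 2 / (a (2 * k) * a (2 * k + 2))
        < 1 / Real.cos (Real.pi / ((n : ℝ) + 2)) ^ 2) :
    (tridiagOfCoeffs n a).PosDef := by
  refine Matrix.PosDef.of_dotProduct_mulVec_pos ?_ ?_
  · ext i j
    simp only [Matrix.conjTranspose_apply, tridiagOfCoeffs, Matrix.of_apply, star_trivial]
    split_ifs <;> first | rfl | omega | simp_all
  · intro x hx
    set y : ℕ → ℝ := fun k => if h : k < n + 1 then x ⟨k, h⟩ else 0 with hy
    have hyx : ∀ i : Fin (n + 1), y i = x i := fun i => dif_pos i.2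
    have e : star x ⬝ᵥ (Matrix.mulVec (tridiagOfCoeffs n a) x) = tdForm a y n := by
      rw [← td_sum, Finset.sum_range]
      simp only [dotProduct, Matrix.mulVec, Finset.mul_sum]
      refine Finset.sum_congr rfl fun i _ => ?_
      rw [Finset.sum_range]
      refine Finset.sum_congr rfl fun j _ => ?_
      rw [hyx, hyx]
      rfl
    rw [e]
    obtain ⟨_, h2⟩ := td_main n hn a y hpos hineq
    by_contra hcon
    apply hx
    ext i
    rw [← hyx]
    exact h2 (not_lt.1 hcon) i (by omega)
end

section
/- Let n be a positive integer and let a_0, a_1, …, a_{2n} be strictly positive real numbers satisfying a_{2k+1}^2 / (a_{2k} · a_{2k+2}) < 1 / cos²(π/(n+2)) for all k = 0, 1, …, n−1. Then all leading principal minors of the (n+1)×(n+1) symmetric tridiagonal matrix M with diagonal entries a_0, a_2, …, a_{2n} and off-diagonal entries a_1/2, a_3/2, …, a_{2n−1}/2 are strictly positive. -/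
noncomputable def triF (a : ℕ → ℝ) (i j : ℕ) : ℝ :=
    if i = j then a (2 * i)
    else if i + 1 = j then a (2 * i + 1) / 2
    else if j + 1 = i then a (2 * j + 1) / 2
    else 0

noncomputable def triD (a : ℕ → ℝ) (m : ℕ) : ℝ :=
  Matrix.det (Matrix.of fun i j : Fin m => triF a i j)

lemma triD_rec (a : ℕ → ℝ) (m : ℕ) :
    triD a (m + 2) = a (2 * m + 2) * triD a (m + 1) - (a (2 * m + 1) / 2) ^ 2 * triD a m := by
  have h1 : ((Matrix.of fun i j : Fin (m+2) => triF a i j).submatrix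
      (Fin.last (m+1)).succAbove (Fin.last m).castSucc.succAbove).det
      = (a (2 * m + 1) / 2) * triD a m := by
    rw [Matrix.det_succ_column _ (Fin.last m), Fin.sum_univ_castSucc, Finset.sum_eq_zero]
    · have e : (((Matrix.of fun i j : Fin (m+2) => triF a i j).submatrix
          (Fin.last (m+1)).succAbove (Fin.last m).castSucc.succAbove).submatrix
          (Fin.last m).succAbove (Fin.last m).succAbove) =
          Matrix.of fun i j : Fin m => triF a i j := by
        ext i j
        have : (Fin.last m).castSucc.succAbove j.castSucc = j.castSucc.castSucc :=
          Fin.succAbove_of_castSucc_lt _ _ (by simp [Fin.lt_def])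
        simp [this]
      have h2 : (Fin.last m).castSucc.succAbove (Fin.last m) = Fin.last (m+1) := by
        rw [Fin.succAbove_of_le_castSucc _ _ (by simp)]; simp
      rw [e]
      simp [h2, triD, triF, ← two_mul]
    · intro i _
      have h2 : (Fin.last m).castSucc.succAbove (Fin.last m) = Fin.last (m+1) := by
        rw [Fin.succAbove_of_le_castSucc _ _ (by simp)]; simp
      have h3 := i.2
      have : triF a i (m+1) = 0 := by
        unfold triF; rw [if_neg (by omega), if_neg (by omega), if_neg (by omega)]
      simp [h2, this]
  conv_lhs => unfold triD
  rw [Matrix.det_succ_row _ (Fin.last (m+1)), Fin.sum_univ_castSucc, Fin.sum_univ_castSucc,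
    Finset.sum_eq_zero, h1]
  · have e : ((Matrix.of fun i j : Fin (m+2) => triF a i j).submatrix
      (Fin.last (m+1)).succAbove (Fin.last (m+1)).succAbove).det = triD a (m+1) := by
      unfold triD; congr 1; ext i j; simp
    rw [e]
    have p1 : ((-1:ℝ)) ^ (m + 1 + m) = -1 := Odd.neg_one_pow ⟨m, by ring⟩
    have p2 : ((-1:ℝ)) ^ (m + 1 + (m+1)) = 1 := Even.neg_one_pow ⟨m+1, by ring⟩
    have f1 : triF a (m+1) m = a (2*m+1)/2 := by
      unfold triF; rw [if_neg (by omega), if_neg (by omega), if_pos (by omega)]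
    have f2 : triF a (m+1) (m+1) = a (2*m+2) := by
      unfold triF; rw [if_pos rfl]; ring_nf
    simp only [Fin.val_last, Fin.val_castSucc, Matrix.of_apply, p1, p2, f1, f2]
    ring
  · intro i _
    have h3 := i.2
    have : triF a (m+1) i = 0 := by
      unfold triF; rw [if_neg (by omega), if_neg (by omega), if_neg (by omega)]
    simp [this]

theorem tridiag_leading_principal_minors_pos (n : ℕ) (hn : 0 < n) (a : ℕ → ℝ)
    (hpos : ∀ k ≤ 2 * n, 0 < a k)
    (hineq : ∀ k < n,
      (a (2 * k + 1)) ^ 2 / (a (2 * k) * a (2 * k + 2))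
        < 1 / Real.cos (Real.pi / ((n : ℝ) + 2)) ^ 2) :
    ∀ j : ℕ, ∀ hj : j ≤ n,
      0 < Matrix.det
        ((tridiagOfCoeffs n a).submatrix
          (Fin.castLE (by omega) : Fin (j + 1) → Fin (n + 1))
          (Fin.castLE (by omega) : Fin (j + 1) → Fin (n + 1))) := by
  set θ : ℝ := Real.pi / ((n : ℝ) + 2) with hθ
  have hn1 : (1:ℝ) ≤ n := by exact_mod_cast hn
  have hπ := Real.pi_pos
  have hθ0 : 0 < θ := by positivity
  have hθn : θ * (n + 2) = Real.pi := by rw [hθ]; field_simp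
  have hc : 0 < Real.cos θ := Real.cos_pos_of_mem_Ioo ⟨by linarith, by nlinarith⟩
  have hs : ∀ k : ℕ, k ≤ n → 0 < Real.sin ((k + 1) * θ) := by
    intro k hk
    have hk' : (k:ℝ) ≤ n := by exact_mod_cast hk
    exact Real.sin_pos_of_pos_of_lt_pi (by positivity) (by nlinarith)
  have hs' : ∀ k : ℕ, k ≤ n → 0 ≤ Real.sin ((k + 2) * θ) := by
    intro k hk
    have hk' : (k:ℝ) ≤ n := by exact_mod_cast hk
    exact Real.sin_nonneg_of_nonneg_of_le_pi (by positivity) (by nlinarith)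
  have key : ∀ j : ℕ, j ≤ n → 0 < triD a j ∧ 0 < triD a (j+1) ∧
      a (2*j) * Real.sin ((j+2)*θ) * triD a j
        ≤ 2 * Real.cos θ * Real.sin ((j+1)*θ) * triD a (j+1) := by
    intro j
    induction j with
    | zero =>
      intro _
      have h0 : triD a 0 = 1 := by simp [triD]
      have h1 : triD a 1 = a 0 := by simp [triD, triF]
      refine ⟨by rw [h0]; norm_num, by rw [h1]; exact hpos 0 (by omega), ?_⟩
      simp only [zero_add, h0, h1, Nat.cast_zero, mul_zero, one_mul, Real.sin_two_mul]
      apply le_of_eq; ring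
    | succ j ih =>
      intro hj
      obtain ⟨d0, d1, h⟩ := ih (by omega)
      have a0 := hpos (2*j) (by omega)
      have a1 := hpos (2*j+2) (by omega)
      have hb := hineq j (by omega)
      rw [div_lt_div_iff₀ (by positivity) (by positivity)] at hb
      have s1 := hs j (by omega)
      have s2 := hs (j+1) (by omega)
      have s3 := hs' (j+1) (by omega)
      have hid : Real.sin (((j+1:ℕ)+2)*θ) =
          2 * Real.cos θ * Real.sin (((j+1:ℕ)+1)*θ) - Real.sin ((j+1)*θ) := by
        have e1 : (((j+1:ℕ):ℝ)+2)*θ = (((j+1:ℕ):ℝ)+1)*θ + θ := by ring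
        have e2 : ((j:ℝ)+1)*θ = (((j+1:ℕ):ℝ)+1)*θ - θ := by push_cast; ring
        rw [e1, e2, Real.sin_add, Real.sin_sub]; ring
      have e3 : ((j:ℝ)+2)*θ = (((j+1:ℕ):ℝ)+1)*θ := by push_cast; ring
      rw [e3] at h
      have hr := triD_rec a j
      have e4 : 2 * (j+1) = 2*j+2 := by ring
      rw [e4]
      show _ ∧ 0 < triD a (j+2) ∧ _ ≤ _ * triD a (j+2)
      generalize Real.sin (((j+1:ℕ)+2)*θ) = S3 at *
      generalize Real.sin (((j+1:ℕ)+1)*θ) = S2 at *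
      generalize Real.sin ((j+1)*θ) = S1 at *
      generalize Real.cos θ = c at *
      generalize triD a (j+2) = D2 at *
      generalize triD a (j+1) = D1 at *
      generalize triD a j = D0 at *
      generalize a (2*j+2) = A1 at *
      generalize a (2*j) = A0 at *
      generalize a (2*j+1) = b at *
      have q1 : b^2 * c^2 * (S2 * D0) < A0 * A1 * (S2 * D0) :=
        mul_lt_mul_of_pos_right (by linarith) (by positivity)
      have q2 : A1 * (A0 * S2 * D0) ≤ A1 * (2 * c * S1 * D1) :=
        mul_le_mul_of_nonneg_left h a1.le
      have q3 : 2 * c * (A1 * S3 * D1) < 2 * c * (2 * c * S2 * D2) := by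
        rw [hr, hid]; nlinarith
      have q4 := lt_of_mul_lt_mul_left q3 (by positivity)
      refine ⟨d1, ?_, q4.le⟩
      have q5 : 0 < 2 * c * S2 * D2 := lt_of_le_of_lt (by positivity) q4
      exact pos_of_mul_pos_right q5 (by positivity)
  intro j hj
  have := (key j hj).2.1
  exact this
end

section
/- Let n be a positive integer, set α = π/(n+2), and define Q(x) = ∑_{k=1}^{n} sin(kα) sin((k+1)α) (1+x)² x^{2k−2}. Then Q(x) = 2 cos α ∑_{k=0}^{n} sin²((k+1)α) x^{2k} + 2 ∑_{k=1}^{n} sin(kα) sin((k+1)α) x^{2k−1} as polynomials; that is, writing Q(x) = ∑_{j=0}^{2n} a_j x^j, one has a_{2k} = 2 sin²((k+1)α) cos α for k = 0, 1, …, n and a_{2k−1} = 2 sin(kα) sin((k+1)α) for k = 1, …, n. -/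
open Polynomial in
theorem Q_aux (α : ℝ) (n : ℕ) :
    (∑ j ∈ Finset.Icc 1 n,
        C (Real.sin ((j : ℝ) * α) * Real.sin (((j : ℝ) + 1) * α))
          * (1 + X) ^ 2 * X ^ (2 * j - 2) : ℝ[X])
      + C (Real.sin (((n : ℝ) + 1) * α) * Real.sin (((n : ℝ) + 2) * α)) * X ^ (2 * n)
      = (∑ j ∈ Finset.range (n + 1),
          C (2 * Real.sin (((j : ℝ) + 1) * α) ^ 2 * Real.cos α) * X ^ (2 * j))
        + ∑ j ∈ Finset.Icc 1 n,
            C (2 * Real.sin ((j : ℝ) * α) * Real.sin (((j : ℝ) + 1) * α))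
              * X ^ (2 * j - 1) := by
  induction n with
  | zero =>
    simp only [Nat.cast_zero, zero_add, one_mul, Real.sin_two_mul]
    simp
    ring
  | succ m ih =>
    rw [Finset.sum_Icc_succ_top (by omega), Finset.sum_Icc_succ_top (by omega),
      Finset.sum_range_succ _ (m + 1)]
    have e1 : 2 * (m + 1) - 2 = 2 * m := by omega
    have e2 : 2 * (m + 1) - 1 = 2 * m + 1 := by omega
    have e3 : 2 * (m + 1) = 2 * m + 2 := by omega
    rw [e1, e2, e3]
    push_cast
    have a1 : ((m : ℝ) + 1 + 1) = m + 2 := by ring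
    have a2 : ((m : ℝ) + 1 + 2) = m + 3 := by ring
    rw [a1, a2]
    have t : Real.sin (((m : ℝ) + 3) * α)
        = 2 * Real.sin (((m : ℝ) + 2) * α) * Real.cos α - Real.sin (((m : ℝ) + 1) * α) := by
      have b1 : ((m : ℝ) + 3) * α = ((m : ℝ) + 2) * α + α := by ring
      have b2 : ((m : ℝ) + 1) * α = ((m : ℝ) + 2) * α - α := by ring
      rw [b1, b2, Real.sin_add, Real.sin_sub]
      ring
    rw [t]
    simp only [C_mul, C_sub, C_pow, pow_add] at ih ⊢
    have c2 : (C (2 : ℝ) : ℝ[X]) = 2 := rfl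
    simp only [c2] at ih ⊢
    linear_combination ih

open Polynomial in
theorem Q_expansion (n : ℕ) (hn : 0 < n) (α : ℝ) (hα : α = Real.pi / ((n : ℝ) + 2)) :
    (∑ j ∈ Finset.Icc 1 n,
        C (Real.sin ((j : ℝ) * α) * Real.sin (((j : ℝ) + 1) * α))
          * (1 + X) ^ 2 * X ^ (2 * j - 2) : ℝ[X])
      = (∑ j ∈ Finset.range (n + 1),
          C (2 * Real.sin (((j : ℝ) + 1) * α) ^ 2 * Real.cos α) * X ^ (2 * j))
        + ∑ j ∈ Finset.Icc 1 n,
            C (2 * Real.sin ((j : ℝ) * α) * Real.sin (((j : ℝ) + 1) * α))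
              * X ^ (2 * j - 1) ∧
    (∀ k ≤ n,
      (∑ j ∈ Finset.Icc 1 n,
        C (Real.sin ((j : ℝ) * α) * Real.sin (((j : ℝ) + 1) * α))
          * (1 + X) ^ 2 * X ^ (2 * j - 2) : ℝ[X]).coeff (2 * k)
        = 2 * Real.sin (((k : ℝ) + 1) * α) ^ 2 * Real.cos α) ∧
    (∀ k, 1 ≤ k → k ≤ n →
      (∑ j ∈ Finset.Icc 1 n,
        C (Real.sin ((j : ℝ) * α) * Real.sin (((j : ℝ) + 1) * α))
          * (1 + X) ^ 2 * X ^ (2 * j - 2) : ℝ[X]).coeff (2 * k - 1)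
        = 2 * Real.sin ((k : ℝ) * α) * Real.sin (((k : ℝ) + 1) * α)) := by
  have h : (∑ j ∈ Finset.Icc 1 n,
        C (Real.sin ((j : ℝ) * α) * Real.sin (((j : ℝ) + 1) * α))
          * (1 + X) ^ 2 * X ^ (2 * j - 2) : ℝ[X])
      = (∑ j ∈ Finset.range (n + 1),
          C (2 * Real.sin (((j : ℝ) + 1) * α) ^ 2 * Real.cos α) * X ^ (2 * j))
        + ∑ j ∈ Finset.Icc 1 n,
            C (2 * Real.sin ((j : ℝ) * α) * Real.sin (((j : ℝ) + 1) * α))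
              * X ^ (2 * j - 1) := by
    rw [← Q_aux]
    have : ((n : ℝ) + 2) * α = Real.pi := by
      rw [hα]
      field_simp
    rw [this]
    simp
  refine ⟨h, fun k hk => ?_, fun k hk1 hk => ?_⟩
  · rw [h, coeff_add, finset_sum_coeff, finset_sum_coeff,
      Finset.sum_eq_single_of_mem k (by simp; omega), Finset.sum_eq_zero]
    · rw [coeff_C_mul_X_pow, if_pos rfl, add_zero]
    · intro j hj
      rw [Finset.mem_Icc] at hj
      rw [coeff_C_mul_X_pow, if_neg (by omega)]
    · intro j hj hne
      rw [coeff_C_mul_X_pow, if_neg (by omega)]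
  · rw [h, coeff_add, finset_sum_coeff, finset_sum_coeff, Finset.sum_eq_zero,
      Finset.sum_eq_single_of_mem k (by simp; omega)]
    · rw [coeff_C_mul_X_pow, if_pos rfl, zero_add]
    · intro j hj hne
      rw [Finset.mem_Icc] at hj
      rw [coeff_C_mul_X_pow, if_neg (by omega)]
    · intro j hj
      rw [coeff_C_mul_X_pow, if_neg (by omega)]
end

section
/- Let n be a positive integer, set α = π/(n+2), and define a_{2k} = 2 sin²((k+1)α) cos α for k = 0, 1, …, n and a_{2k−1} = 2 sin(kα) sin((k+1)α) for k = 1, …, n. Then all these numbers a_0, a_1, …, a_{2n} are strictly positive, and a_{2k+1}^2 / (a_{2k} · a_{2k+2}) = 1 / cos²(α) for every k = 0, 1, …, n−1. -/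
theorem Q_coeffs_pos_and_ratio (n : ℕ) (hn : 0 < n) (α : ℝ)
    (hα : α = Real.pi / ((n : ℝ) + 2)) (a : ℕ → ℝ)
    (ha_even : ∀ k ≤ n,
      a (2 * k) = 2 * Real.sin (((k : ℝ) + 1) * α) ^ 2 * Real.cos α)
    (ha_odd : ∀ k, 1 ≤ k → k ≤ n →
      a (2 * k - 1) = 2 * Real.sin ((k : ℝ) * α) * Real.sin (((k : ℝ) + 1) * α)) :
    (∀ k ≤ 2 * n, 0 < a k) ∧
    ∀ k < n,
      (a (2 * k + 1)) ^ 2 / (a (2 * k) * a (2 * k + 2)) = 1 / Real.cos α ^ 2 := by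
  have hn1 : (1 : ℝ) ≤ n := by exact_mod_cast hn
  have hpi := Real.pi_pos
  have hα0 : 0 < α := by rw [hα]; positivity
  have hmul : ((n : ℝ) + 2) * α = Real.pi := by
    rw [hα]; field_simp
  have hcos : 0 < Real.cos α := by
    apply Real.cos_pos_of_mem_Ioo
    constructor
    · linarith
    · nlinarith
  have hsin : ∀ k : ℕ, k ≤ n → 0 < Real.sin (((k : ℝ) + 1) * α) := by
    intro k hk
    have hk' : (k : ℝ) ≤ n := by exact_mod_cast hk
    apply Real.sin_pos_of_pos_of_lt_pi
    · positivity
    · nlinarith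
  have hodd : ∀ k < n, a (2 * k + 1) =
      2 * Real.sin (((k : ℝ) + 1) * α) * Real.sin ((((k + 1 : ℕ) : ℝ) + 1) * α) := by
    intro k hk
    have h := ha_odd (k + 1) (by omega) (by omega)
    rw [show 2 * (k + 1) - 1 = 2 * k + 1 by omega] at h
    rw [h]; push_cast; rfl
  constructor
  · intro k hk
    rcases Nat.even_or_odd' k with ⟨m, rfl | rfl⟩
    · rw [ha_even m (by omega)]
      have := hsin m (by omega)
      positivity
    · rw [hodd m (by omega)]
      have h1 := hsin m (by omega)
      have h2 := hsin (m + 1) (by omega)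
      positivity
  · intro k hk
    have h1 := hsin k (by omega)
    have h2 := hsin (k + 1) (by omega)
    rw [hodd k hk, ha_even k (by omega), show 2 * k + 2 = 2 * (k + 1) by ring,
      ha_even (k + 1) (by omega)]
    generalize Real.sin (((k : ℝ) + 1) * α) = x at *
    generalize Real.sin ((((k + 1 : ℕ) : ℝ) + 1) * α) = y at *
    rw [div_eq_div_iff (by positivity) (by positivity)]
    ring
end

section
/- Let n be a positive integer, set α = π/(n+2), define H(x) = ∑_{k=1}^{n} sin(kα) sin((k+1)α) ( x^{2k−1}/(2k−1) + 2 x^{2k}/(2k) + x^{2k+1}/(2k+1) ) and S(x) = H(x) − H(−1). Then S is a polynomial of degree 2n+1 with all coefficients strictly positive, and −1 is a root of S of multiplicity at least 3 (i.e., S(−1) = S′(−1) = S″(−1) = 0). -/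
open Polynomial in
theorem S_term_deriv (k : ℕ) (hk : 1 ≤ k) (a : ℝ) :
    derivative (C a * (C (1 / (2 * (k : ℝ) - 1)) * X ^ (2 * k - 1)
            + C (2 / (2 * (k : ℝ))) * X ^ (2 * k)
            + C (1 / (2 * (k : ℝ) + 1)) * X ^ (2 * k + 1)))
      = (X + 1) ^ 2 * (C a * X ^ (2 * k - 2)) := by
  obtain ⟨j, rfl⟩ : ∃ j, k = j + 1 := ⟨k - 1, by omega⟩
  have e1 : 2 * (j + 1) - 1 = 2 * j + 1 := by omega
  have e2 : 2 * (j + 1) - 2 = 2 * j := by omega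
  have e3 : 2 * (j + 1) = 2 * j + 1 + 1 := by omega
  rw [e1, e2, e3]
  simp only [derivative_C_mul, derivative_add, derivative_X_pow, Nat.add_sub_cancel, ← mul_assoc,
    mul_add, ← C_mul]
  have h1 : (2 * (j : ℝ) + 1) ≠ 0 := by positivity
  have h2 : (2 * (j : ℝ) + 1 + 1) ≠ 0 := by positivity
  have h3 : (2 * (j : ℝ) + 1 + 1 + 1) ≠ 0 := by positivity
  have c1 : a * (1 / (2 * ((j + 1 : ℕ) : ℝ) - 1)) * ((2 * j + 1 : ℕ) : ℝ) = a := by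
    push_cast
    rw [show 2 * ((j : ℝ) + 1) - 1 = 2 * j + 1 by ring]
    field_simp
  have c2 : a * (2 / (2 * ((j + 1 : ℕ) : ℝ))) * ((2 * j + 1 + 1 : ℕ) : ℝ) = 2 * a := by
    push_cast
    rw [show 2 * ((j : ℝ) + 1) = 2 * j + 1 + 1 by ring]
    field_simp
  have c3 : a * (1 / (2 * ((j + 1 : ℕ) : ℝ) + 1)) * ((2 * j + 1 + 1 + 1 : ℕ) : ℝ) = a := by
    push_cast
    rw [show 2 * ((j : ℝ) + 1) + 1 = 2 * j + 1 + 1 + 1 by ring]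
    field_simp
  rw [c1, c2, c3]
  simp only [C_mul]
  rw [show (C (2:ℝ) : ℝ[X]) = 2 from rfl]
  ring

open Polynomial in
theorem S_degree_coeffs_triple_root (n : ℕ) (hn : 0 < n) (α : ℝ)
    (hα : α = Real.pi / ((n : ℝ) + 2))
    (H S : ℝ[X])
    (hH : H = ∑ k ∈ Finset.Icc 1 n,
      C (Real.sin ((k : ℝ) * α) * Real.sin (((k : ℝ) + 1) * α))
        * (C (1 / (2 * (k : ℝ) - 1)) * X ^ (2 * k - 1)
            + C (2 / (2 * (k : ℝ))) * X ^ (2 * k)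
            + C (1 / (2 * (k : ℝ) + 1)) * X ^ (2 * k + 1)))
    (hS : S = H - C (H.eval (-1))) :
    S.natDegree = 2 * n + 1 ∧
    (∀ k ≤ 2 * n + 1, 0 < S.coeff k) ∧
    S.eval (-1) = 0 ∧
    (Polynomial.derivative S).eval (-1) = 0 ∧
    (Polynomial.derivative (Polynomial.derivative S)).eval (-1) = 0 := by
  have hαpos : 0 < α := by rw [hα]; have := Real.pi_pos; positivity
  have hαn : ((n : ℝ) + 2) * α = Real.pi := by rw [hα]; field_simp
  have hsin : ∀ t : ℝ, 0 < t → t ≤ n + 1 → 0 < Real.sin (t * α) := by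
    intro t h0 h1
    apply Real.sin_pos_of_pos_of_lt_pi (by positivity)
    rw [← hαn]
    exact mul_lt_mul_of_pos_right (by linarith) hαpos
  have ha : ∀ k ∈ Finset.Icc 1 n,
      0 < Real.sin ((k : ℝ) * α) * Real.sin (((k : ℝ) + 1) * α) := by
    intro k hk
    rw [Finset.mem_Icc] at hk
    have h1 : (1 : ℝ) ≤ k := by exact_mod_cast hk.1
    have h2 : (k : ℝ) ≤ n := by exact_mod_cast hk.2
    exact mul_pos (hsin _ (by linarith) (by linarith)) (hsin _ (by linarith) (by linarith))
  generalize hA : (fun k : ℕ => Real.sin ((k : ℝ) * α) * Real.sin (((k : ℝ) + 1) * α)) = A at *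
  have hA' : ∀ k : ℕ, Real.sin ((k : ℝ) * α) * Real.sin (((k : ℝ) + 1) * α) = A k :=
    fun k => congrFun hA k
  simp only [hA'] at hH ha
  have hcoef : ∀ m, H.coeff m = ∑ k ∈ Finset.Icc 1 n, A k *
      ((if m = 2 * k - 1 then 1 / (2 * (k : ℝ) - 1) else 0)
        + (if m = 2 * k then 2 / (2 * (k : ℝ)) else 0)
        + (if m = 2 * k + 1 then 1 / (2 * (k : ℝ) + 1) else 0)) := by
    intro m
    rw [hH, finset_sum_coeff]
    refine Finset.sum_congr rfl fun k _ => ?_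
    simp only [coeff_C_mul, coeff_add, coeff_X_pow, mul_ite, mul_one, mul_zero]
  have hHneg : H.eval (-1) < 0 := by
    rw [hH, eval_finset_sum]
    apply Finset.sum_neg
    · intro k hk
      have hak := ha k hk
      rw [Finset.mem_Icc] at hk
      have h1 : (1 : ℝ) ≤ k := by exact_mod_cast hk.1
      simp only [eval_mul, eval_add, eval_C, eval_pow, eval_X]
      rw [Odd.neg_one_pow (n := 2 * k - 1) ⟨k - 1, by omega⟩,
        Odd.neg_one_pow (n := 2 * k + 1) ⟨k, rfl⟩, Even.neg_one_pow (n := 2 * k) ⟨k, by omega⟩]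
      apply mul_neg_of_pos_of_neg hak
      have p1 : (0:ℝ) < 2 * k - 1 := by linarith
      have p2 : (0:ℝ) < 2 * k + 1 := by linarith
      have p3 : (0:ℝ) < k := by linarith
      have : 1 / (2 * (k : ℝ) - 1) * -1 + 2 / (2 * (k : ℝ)) * 1 + 1 / (2 * (k : ℝ) + 1) * -1
          = - (1 / (k * (2 * k - 1) * (2 * k + 1))) := by
        have := p1.ne'
        field_simp
        ring
      rw [this]
      exact neg_neg_of_pos (by positivity)
    · exact ⟨1, by simp; omega⟩
  have hnn : ∀ m, ∀ k ∈ Finset.Icc 1 n, 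
      0 ≤ (if m = 2 * k - 1 then 1 / (2 * (k : ℝ) - 1) else 0) ∧
      0 ≤ (if m = 2 * k then 2 / (2 * (k : ℝ)) else 0) ∧
      0 ≤ (if m = 2 * k + 1 then 1 / (2 * (k : ℝ) + 1) else 0) := by
    intro m k hk
    rw [Finset.mem_Icc] at hk
    have h1 : (1 : ℝ) ≤ k := by exact_mod_cast hk.1
    have p1 : (0:ℝ) < 2 * k - 1 := by linarith
    refine ⟨?_, ?_, ?_⟩ <;> split_ifs <;> positivity
  have hpos : ∀ m ≤ 2 * n + 1, 0 < S.coeff m := by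
    intro m hm
    rw [hS, coeff_sub, coeff_C, hcoef]
    rcases Nat.eq_zero_or_pos m with rfl | hm0
    · have : 0 ≤ ∑ k ∈ Finset.Icc 1 n, A k *
        ((if 0 = 2 * k - 1 then 1 / (2 * (k : ℝ) - 1) else 0)
        + (if 0 = 2 * k then 2 / (2 * (k : ℝ)) else 0)
        + (if 0 = 2 * k + 1 then 1 / (2 * (k : ℝ) + 1) else 0)) := by
        refine Finset.sum_nonneg fun k hk => ?_
        obtain ⟨q1, q2, q3⟩ := hnn 0 k hk
        exact mul_nonneg (ha k hk).le (by linarith)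
      rw [if_pos rfl]
      linarith
    · rw [if_neg (by omega), sub_zero]
      apply Finset.sum_pos'
      · intro k hk
        obtain ⟨q1, q2, q3⟩ := hnn m k hk
        exact mul_nonneg (ha k hk).le (by linarith)
      · obtain ⟨k, hk1, hk2, hk⟩ : ∃ k, 1 ≤ k ∧ k ≤ n ∧
            (m = 2 * k - 1 ∨ m = 2 * k ∨ m = 2 * k + 1) := by
          by_cases h : m = 2 * n + 1
          · exact ⟨n, by omega, le_rfl, by omega⟩
          · exact ⟨(m + 1) / 2, by omega, by omega, by omega⟩
        have hkm : k ∈ Finset.Icc 1 n := Finset.mem_Icc.2 ⟨hk1, hk2⟩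
        refine ⟨k, hkm, mul_pos (ha k hkm) ?_⟩
        obtain ⟨q1, q2, q3⟩ := hnn m k hkm
        have h1 : (1 : ℝ) ≤ k := by exact_mod_cast hk1
        have p1 : (0:ℝ) < 2 * k - 1 := by linarith
        rcases hk with h | h | h
        · have : 0 < (if m = 2 * k - 1 then 1 / (2 * (k : ℝ) - 1) else 0) := by
            rw [if_pos h]; positivity
          linarith
        · have : 0 < (if m = 2 * k then 2 / (2 * (k : ℝ)) else 0) := by
            rw [if_pos h]; positivity
          linarith
        · have : 0 < (if m = 2 * k + 1 then 1 / (2 * (k : ℝ) + 1) else 0) := by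
            rw [if_pos h]; positivity
          linarith
  have hder : derivative S = (X + 1) ^ 2 * ∑ k ∈ Finset.Icc 1 n, C (A k) * X ^ (2 * k - 2) := by
    rw [hS, derivative_sub, derivative_C, sub_zero, hH, derivative_sum, Finset.mul_sum]
    exact Finset.sum_congr rfl fun k hk => S_term_deriv k (Finset.mem_Icc.1 hk).1 _
  refine ⟨?_, hpos, ?_, ?_, ?_⟩
  · apply natDegree_eq_of_le_of_coeff_ne_zero
    · rw [natDegree_le_iff_coeff_eq_zero]
      intro m hm
      rw [hS, coeff_sub, coeff_C, if_neg (by omega), sub_zero, hcoef]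
      refine Finset.sum_eq_zero fun k hk => ?_
      rw [Finset.mem_Icc] at hk
      rw [if_neg (by omega), if_neg (by omega), if_neg (by omega)]
      simp
    · exact (hpos _ le_rfl).ne'
  · rw [hS]; simp
  · rw [hder]; simp
  · rw [hder]; simp [derivative_mul, derivative_pow]
end

section
/- Let n be a positive integer and let P(x) = ∑_{k=0}^{2n+1} a_k x^k be a real polynomial with all coefficients strictly positive satisfying a_{2k}^2 / (a_{2k−1} · a_{2k+1}) < ((4k² − 1)/(4k²)) · (1 / cos²(π/(n+2))) for all k = 1, 2, …, n. Then the derivative P′ satisfies P′(x) > 0 for every real x, i.e., P is strictly increasing on ℝ. -/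
lemma quad_pos_aux (A B C x : ℝ) (hA : 0 < A) (h : B ^ 2 < 4 * A * C) :
    0 < A + B * x + C * x ^ 2 := by
  have h1 : 0 < 4 * A * (A + B * x + C * x ^ 2) := by
    have e : 4 * A * (A + B * x + C * x ^ 2) = (2 * A + B * x) ^ 2 + (4 * A * C - B ^ 2) * x ^ 2 := by
      ring
    rw [e]
    rcases eq_or_ne x 0 with rfl | hx
    · simp; positivity
    · have : 0 < x ^ 2 := by positivity
      have := mul_pos (sub_pos.2 h) this
      positivity
  exact (pos_iff_pos_of_mul_pos h1).1 (by positivity)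

lemma odd_deriv_aux (n : ℕ) (hn : 0 < n) (b : ℕ → ℝ)
    (hpos : ∀ k ≤ 2 * n, 0 < b k) (θ : ℝ) (hθ : θ = Real.pi / ((n : ℝ) + 2))
    (hb : ∀ m < n, (Real.cos θ * b (2 * m + 1)) ^ 2 < b (2 * m) * b (2 * m + 2))
    (x : ℝ) : 0 < ∑ k ∈ Finset.range (2 * n + 1), b k * x ^ k := by
  have hn1 : (1 : ℝ) ≤ n := by exact_mod_cast hn
  have hpi := Real.pi_pos
  have hθm : ((n : ℝ) + 2) * θ = Real.pi := by rw [hθ]; field_simp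
  have hθ0 : 0 < θ := by rw [hθ]; positivity
  have hcos : 0 < Real.cos θ := by
    apply Real.cos_pos_of_mem_Ioo
    constructor <;> nlinarith
  have hs : ∀ m : ℕ, m ≤ n → 0 < Real.sin (((m : ℝ) + 1) * θ) := by
    intro m hm
    have hm' : (m : ℝ) ≤ n := by exact_mod_cast hm
    apply Real.sin_pos_of_pos_of_lt_pi
    · positivity
    · nlinarith
  rcases eq_or_ne x 0 with rfl | hx
  · rw [Finset.sum_range_succ']
    simpa using hpos 0 (by omega)
  have hrec : ∀ m : ℕ, Real.sin (((m : ℝ) + 3) * θ) + Real.sin (((m : ℝ) + 1) * θ)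
      = 2 * Real.cos θ * Real.sin (((m : ℝ) + 2) * θ) := by
    intro m
    rw [show ((m : ℝ) + 3) * θ = ((m : ℝ) + 2) * θ + θ by ring,
      show ((m : ℝ) + 1) * θ = ((m : ℝ) + 2) * θ - θ by ring, Real.sin_add, Real.sin_sub]
    ring
  have step : ∀ m < n, 0 < Real.sin (((m : ℝ) + 2) * θ) / (2 * Real.sin (((m : ℝ) + 1) * θ))
        * b (2 * m) * x ^ (2 * m) + Real.cos θ * (b (2 * m + 1) * x ^ (2 * m + 1)
        + b (2 * m + 2) * x ^ (2 * m + 2))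
        - Real.sin (((m : ℝ) + 3) * θ) / (2 * Real.sin (((m : ℝ) + 2) * θ))
          * b (2 * m + 2) * x ^ (2 * m + 2) := by
    intro m hm
    have s1 := hs m hm.le
    have s2 := hs (m + 1) hm
    push_cast at s2
    rw [show (m : ℝ) + 1 + 1 = m + 2 by ring] at s2
    have hr := hrec m
    have hbm := hb m hm
    have p0 := hpos (2 * m) (by omega)
    set S1 := Real.sin (((m : ℝ) + 1) * θ)
    set S2 := Real.sin (((m : ℝ) + 2) * θ)
    set S3 := Real.sin (((m : ℝ) + 3) * θ)
    have hq := quad_pos_aux (S2 / (2 * S1) * b (2 * m)) (Real.cos θ * b (2 * m + 1))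
      (S1 / (2 * S2) * b (2 * m + 2)) x (by positivity) (by
        have : 4 * (S2 / (2 * S1) * b (2 * m)) * (S1 / (2 * S2) * b (2 * m + 2))
          = b (2 * m) * b (2 * m + 2) := by field_simp; norm_num
        rw [this]; exact hbm)
    have hx2 : 0 < x ^ (2 * m) := by rw [pow_mul]; positivity
    have := mul_pos hx2 hq
    have e : S3 / (2 * S2) = Real.cos θ - S1 / (2 * S2) := by
      field_simp; linarith
    rw [e]
    refine lt_of_lt_of_eq this ?_
    ring
  have main : ∀ m : ℕ, m < n → Real.sin (((m : ℝ) + 3) * θ) / (2 * Real.sin (((m : ℝ) + 2) * θ))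
          * b (2 * m + 2) * x ^ (2 * m + 2) <
      Real.cos θ * ∑ k ∈ Finset.range (2 * m + 3), b k * x ^ k := by
    intro m
    induction m with
    | zero =>
      intro h0
      have h := step 0 h0
      have s1 := hs 0 h0.le
      simp only [Finset.sum_range_succ, Finset.sum_range_zero]
      simp only [Nat.cast_zero, zero_add, one_mul, mul_zero, pow_zero, mul_one, pow_one] at h s1 ⊢
      have e : Real.sin (2 * θ) / (2 * Real.sin θ) = Real.cos θ := by
        rw [Real.sin_two_mul]; field_simp
      rw [e] at h
      linarith
    | succ m ih =>
      intro hm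
      have h := step (m + 1) hm
      have i := ih (by omega)
      rw [show 2 * (m + 1) + 3 = 2 * m + 3 + 1 + 1 by ring, Finset.sum_range_succ,
        Finset.sum_range_succ]
      push_cast at h ⊢
      rw [show (m : ℝ) + 1 + 1 = m + 2 by ring, show (m : ℝ) + 1 + 2 = m + 3 by ring] at h
      rw [show (m : ℝ) + 1 + 2 = m + 3 by ring]
      simp only [show 2 * (m + 1) = 2 * m + 2 by ring, add_assoc, Nat.reduceAdd] at h ⊢
      linarith
  obtain ⟨m, rfl⟩ : ∃ m, n = m + 1 := ⟨n - 1, by omega⟩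
  have h := main m (by omega)
  push_cast at hθm
  rw [show ((m : ℝ) + 3) * θ = Real.pi by linarith, Real.sin_pi] at h
  simp only [zero_div, zero_mul] at h
  exact (pos_iff_pos_of_mul_pos h).1 hcos

theorem odd_degree_strictly_increasing (n : ℕ) (hn : 0 < n) (a : ℕ → ℝ)
    (hpos : ∀ k ≤ 2 * n + 1, 0 < a k)
    (hineq : ∀ k, 1 ≤ k → k ≤ n →
      (a (2 * k)) ^ 2 / (a (2 * k - 1) * a (2 * k + 1))
        < ((4 * (k : ℝ) ^ 2 - 1) / (4 * (k : ℝ) ^ 2))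
            * (1 / Real.cos (Real.pi / ((n : ℝ) + 2)) ^ 2)) :
    (∀ x : ℝ, 0 < deriv (fun y : ℝ => ∑ k ∈ Finset.range (2 * n + 2), a k * y ^ k) x) ∧
    StrictMono (fun y : ℝ => ∑ k ∈ Finset.range (2 * n + 2), a k * y ^ k) := by
  have key : ∀ x : ℝ, 0 < deriv (fun y : ℝ => ∑ k ∈ Finset.range (2 * n + 2), a k * y ^ k) x := by
    intro x
    have hd : HasDerivAt (fun y : ℝ => ∑ k ∈ Finset.range (2 * n + 2), a k * y ^ k)
        (∑ k ∈ Finset.range (2 * n + 2), a k * ((k : ℝ) * x ^ (k - 1))) x :=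
      HasDerivAt.fun_sum fun k _ => (hasDerivAt_pow k x).const_mul (a k)
    rw [hd.deriv, Finset.sum_range_succ']
    have := odd_deriv_aux n hn (fun k => ((k : ℝ) + 1) * a (k + 1))
      (fun k hk => mul_pos (by positivity) (hpos _ (by omega))) _ rfl (by
        intro m hm
        have h := hineq (m + 1) (by omega) (by omega)
        have hpi := Real.pi_pos
        have hn1 : (1 : ℝ) ≤ n := by exact_mod_cast hn
        have hcos : 0 < Real.cos (Real.pi / ((n : ℝ) + 2)) := by
          apply Real.cos_pos_of_mem_Ioo
          constructor
          · have : 0 < Real.pi / ((n : ℝ) + 2) := by positivity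
            linarith
          · apply div_lt_div_of_pos_left hpi (by norm_num) (by linarith)
        set c := Real.cos (Real.pi / ((n : ℝ) + 2))
        have p1 := hpos (2 * m + 1) (by omega)
        have p3 := hpos (2 * m + 3) (by omega)
        rw [show 2 * (m + 1) - 1 = 2 * m + 1 by omega, show 2 * (m + 1) + 1 = 2 * m + 3 by ring,
          show 2 * (m + 1) = 2 * m + 2 by ring, div_mul_div_comm,
          div_lt_div_iff₀ (by positivity) (by positivity)] at h
        push_cast at h ⊢
        simp only [add_assoc, Nat.reduceAdd] at h ⊢
        linarith)
    simpa [mul_comm, mul_left_comm, mul_assoc] using this x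
  exact ⟨key, strictMono_of_deriv_pos key⟩
end
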